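/- arXiv:1804.07499 — 2 statements merged into one kernel-verified Lean document; each statement's English description precedes it below -/
import Mathlib

section
/- Let (X, Π, 𝓑) be a system of d-boxes with each Π_i unital. Let 𝓖₁,…,𝓖_s and 𝓗₁,…,𝓗_s be such that the families 𝓖₁,…,𝓖_s are pairwise disjoint subfamilies of 𝓑, the families 𝓗₁,…,𝓗_s are pairwise disjoint subfamilies of 𝓑, and for each i the families 𝓖_i and 𝓗_i are suits for the same polybox. If 𝓖₁ ∪ ⋯ ∪ 𝓖_s is a suit for a polybox G, then 𝓗₁ ∪ ⋯ ∪ 𝓗_s is a suit for G as well. -/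
open Set

/-- A partition of a type `α`: a family of nonempty pairwise disjoint subsets whose union
is everything. -/
def IsPartition {α : Type*} (π : Set (Set α)) : Prop :=
  (∀ A ∈ π, A.Nonempty) ∧ π.PairwiseDisjoint id ∧ ⋃₀ π = Set.univ

/-- `Coarser π ρ` means `ρ` is coarser than `π`: every part of `π` lies in a part of `ρ`. -/
def Coarser {α : Type*} (π ρ : Set (Set α)) : Prop :=
  ∀ A ∈ π, ∃ B ∈ ρ, A ⊆ B

/-- Two partitions are independent if the only partition coarser than both is the trivial
partition `{univ}`. -/
def IndepPartitions {α : Type*} (π π' : Set (Set α)) : Prop :=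
  ∀ ρ : Set (Set α), IsPartition ρ → Coarser π ρ → Coarser π' ρ → ρ = {Set.univ}

/-- A system of `d`-boxes: each `X i` has at least two elements, and `P i` is a finite
family of pairwise independent finite partitions of `X i`. -/
def IsBoxSystem {d : ℕ} (X : Fin d → Type*) (P : ∀ i, Set (Set (Set (X i)))) : Prop :=
  (∀ i, Nontrivial (X i)) ∧ (∀ i, (P i).Finite) ∧ (∀ i, ∀ π ∈ P i, π.Finite) ∧
    (∀ i, ∀ π ∈ P i, IsPartition π) ∧
    (∀ i, ∀ π ∈ P i, ∀ π' ∈ P i, π ≠ π' → IndepPartitions π π')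

/-- `K` is a box: every factor `K i` is a part of some partition in `P i`. -/
def IsBox {d : ℕ} {X : Fin d → Type*} (P : ∀ i, Set (Set (Set (X i))))
    (K : ∀ i, Set (X i)) : Prop :=
  ∀ i, ∃ π ∈ P i, K i ∈ π

/-- The subset of `X` determined by the box `K`. -/
def boxSet {d : ℕ} {X : Fin d → Type*} (K : ∀ i, Set (X i)) : Set (∀ i, X i) :=
  Set.univ.pi K

/-- Keller's condition for a pair of boxes: in some coordinate the factors are distinct
parts of one partition. -/
def KellerPair {d : ℕ} {X : Fin d → Type*} (P : ∀ i, Set (Set (Set (X i))))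
    (K L : ∀ i, Set (X i)) : Prop :=
  ∃ i, ∃ π ∈ P i, K i ∈ π ∧ L i ∈ π ∧ K i ≠ L i

/-- A Keller family: a nonempty family of boxes any two distinct members of which satisfy
Keller's condition. -/
def IsKellerFamily {d : ℕ} {X : Fin d → Type*} (P : ∀ i, Set (Set (Set (X i))))
    (G : Set (∀ i, Set (X i))) : Prop :=
  G.Nonempty ∧ (∀ K ∈ G, IsBox P K) ∧ ∀ K ∈ G, ∀ L ∈ G, K ≠ L → KellerPair P K L

/-- The union (polybox) of a family of boxes. -/
def polyUnion {d : ℕ} {X : Fin d → Type*} (G : Set (∀ i, Set (X i))) : Set (∀ i, X i) :=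
  ⋃ K ∈ G, boxSet K

/-- The restriction `𝓖|𝓥 = {K ∈ 𝓖 : K i ∈ 𝓥}`. -/
def restrictFam {d : ℕ} {X : Fin d → Type*} (G : Set (∀ i, Set (X i))) (i : Fin d)
    (V : Set (Set (X i))) : Set (∀ i, Set (X i)) :=
  {K ∈ G | K i ∈ V}

/-- An `i`-cylinder: together with any point it contains the whole line through that point
in direction `i`. -/
def IsCylinder {d : ℕ} {X : Fin d → Type*} (i : Fin d) (W : Set (∀ j, X j)) : Prop :=
  ∀ x ∈ W, ∀ y : X i, Function.update x i y ∈ W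

/-- `π` is present in `𝓖` if some box of `𝓖` has its `i`-th factor in `π`. -/
def PresentIn {d : ℕ} {X : Fin d → Type*} (G : Set (∀ i, Set (X i))) (i : Fin d)
    (π : Set (Set (X i))) : Prop :=
  ∃ K ∈ G, K i ∈ π

/-- A nontrivial partition `π ∈ P i` is hidden in `𝓖` if `𝓖|π` is a suit for an
`i`-cylinder. -/
def HiddenIn {d : ℕ} {X : Fin d → Type*} (P : ∀ i, Set (Set (Set (X i))))
    (G : Set (∀ i, Set (X i))) (i : Fin d) (π : Set (Set (X i))) : Prop :=
  π ∈ P i ∧ π ≠ {Set.univ} ∧ IsKellerFamily P (restrictFam G i π) ∧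
    IsCylinder i (polyUnion (restrictFam G i π))

/-- A nontrivial partition `π ∈ P i` is exposed in `𝓖` if it is present and not hidden. -/
def ExposedIn {d : ℕ} {X : Fin d → Type*} (P : ∀ i, Set (Set (Set (X i))))
    (G : Set (∀ i, Set (X i))) (i : Fin d) (π : Set (Set (X i))) : Prop :=
  π ∈ P i ∧ π ≠ {Set.univ} ∧ PresentIn G i π ∧ ¬ HiddenIn P G i π

/-- A nonempty set that is saturated for two independent partitions is everything. -/
lemma indep_univ {α : Type*} {π π' : Set (Set α)} (hi : IndepPartitions π π')
    (S : Set α) (hne : S.Nonempty)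
    (h1 : ∀ A ∈ π, A ⊆ S ∨ A ⊆ Sᶜ) (h2 : ∀ A ∈ π', A ⊆ S ∨ A ⊆ Sᶜ) : S = Set.univ := by
  by_contra hS
  have hc : Sᶜ.Nonempty := Set.nonempty_compl.mpr hS
  have key := hi {S, Sᶜ} ?_ ?_ ?_
  · have : S ∈ ({S, Sᶜ} : Set (Set α)) := by simp
    rw [key] at this
    exact hS this
  · refine ⟨?_, ?_, ?_⟩
    · rintro A (rfl | rfl)
      · exact hne
      · exact hc
    · rintro A (rfl | rfl) B (rfl | rfl) hAB
      · exact absurd rfl hAB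
      · exact disjoint_compl_right
      · exact disjoint_compl_left
      · exact absurd rfl hAB
    · ext x
      simp
  · intro A hA
    rcases h1 A hA with h | h
    · exact ⟨S, by simp, h⟩
    · exact ⟨Sᶜ, by simp, h⟩
  · intro A hA
    rcases h2 A hA with h | h
    · exact ⟨S, by simp, h⟩
    · exact ⟨Sᶜ, by simp, h⟩

/-- Two parts of a partition with a common point coincide. -/
lemma part_eq {α : Type*} {π : Set (Set α)} (hp : IsPartition π) {A B : Set α}
    (hA : A ∈ π) (hB : B ∈ π) {x : α} (hxA : x ∈ A) (hxB : x ∈ B) : A = B := by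
  by_contra h
  exact Set.disjoint_left.mp (hp.2.1 hA hB h) hxA hxB

/-- A union of parts of a partition is saturated. -/
lemma sUnion_sat {α : Type*} {π : Set (Set α)} (hp : IsPartition π) {F : Set (Set α)}
    (hF : F ⊆ π) : ∀ A ∈ π, A ⊆ ⋃₀ F ∨ A ⊆ (⋃₀ F)ᶜ := by
  intro A hA
  by_cases h : A ∈ F
  · exact Or.inl (Set.subset_sUnion_of_mem h)
  · right
    rintro x hx ⟨B, hB, hxB⟩
    exact h (part_eq hp hA (hF hB) hx hxB ▸ hB)

/-- A set is a part of at most one partition of the family. -/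
lemma part_unique {α : Type*} {Q : Set (Set (Set α))} (hpart : ∀ π ∈ Q, IsPartition π)
    (hind : ∀ π ∈ Q, ∀ π' ∈ Q, π ≠ π' → IndepPartitions π π')
    {π π' : Set (Set α)} (hπ : π ∈ Q) (hπ' : π' ∈ Q) {A : Set α} (hA : A ∈ π) (hA' : A ∈ π') :
    π = π' := by
  by_contra hne
  have hn := (hpart π hπ).1 A hA
  have e1 := sUnion_sat (hpart π hπ) (F := {A}) (by simpa using hA)
  have e2 := sUnion_sat (hpart π' hπ') (F := {A}) (by simpa using hA')
  rw [Set.sUnion_singleton] at e1 e2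
  have hu : A = Set.univ := indep_univ (hind π hπ π' hπ' hne) A hn e1 e2
  have aux : ∀ σ ∈ Q, A ∈ σ → σ = {A} := by
    intro σ hσ hAσ
    ext B
    constructor
    · intro hB
      obtain ⟨x, hx⟩ := (hpart σ hσ).1 B hB
      exact part_eq (hpart σ hσ) hB hAσ hx (hu ▸ Set.mem_univ x)
    · rintro rfl
      exact hAσ
  exact hne ((aux π hπ hA).trans (aux π' hπ' hA').symm)

/-- A selector: picks exactly one part of each partition. -/
def IsSelector {α : Type*} (Q : Set (Set (Set α))) (p : Set α → Prop) : Prop :=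
  ∀ π ∈ Q, ∃! A, A ∈ π ∧ p A

/-- The selector determined by a point. -/
lemma point_selector {α : Type*} {Q : Set (Set (Set α))} (hpart : ∀ π ∈ Q, IsPartition π)
    (x : α) : IsSelector Q (fun A => x ∈ A) := by
  intro π hπ
  have hx : x ∈ ⋃₀ π := (hpart π hπ).2.2 ▸ Set.mem_univ x
  obtain ⟨A, hA, hxA⟩ := hx
  exact ⟨A, ⟨hA, hxA⟩, fun B hB => part_eq (hpart π hπ) hB.1 hA hB.2 hxA⟩

/-- One-dimensional step: one-coordinate traces with the same union are hit by the same
selectors. -/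
lemma one_dim {α : Type*} {Q : Set (Set (Set α))} (hpart : ∀ π ∈ Q, IsPartition π)
    (hind : ∀ π ∈ Q, ∀ π' ∈ Q, π ≠ π' → IndepPartitions π π')
    {F F' : Set (Set α)} {π π' : Set (Set α)} (hπ : π ∈ Q) (hπ' : π' ∈ Q)
    (hF : F ⊆ π) (hF' : F' ⊆ π') (hU : ⋃₀ F = ⋃₀ F') {p : Set α → Prop}
    (hp : IsSelector Q p) (h : ∃ A ∈ F, p A) : ∃ A ∈ F', p A := by
  obtain ⟨A, hA, hpA⟩ := h
  obtain ⟨x, hx⟩ := (hpart π hπ).1 A (hF hA)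
  have hxU : x ∈ ⋃₀ F := ⟨A, hA, hx⟩
  by_cases he : π = π'
  · subst he
    rw [hU] at hxU
    obtain ⟨B, hB, hxB⟩ := hxU
    have := part_eq (hpart π hπ) (hF hA) (hF' hB) hx hxB
    exact ⟨A, this ▸ hB, hpA⟩
  · have hu : ⋃₀ F = Set.univ := indep_univ (hind π hπ π' hπ' he) _ ⟨x, hxU⟩
      (sUnion_sat (hpart π hπ) hF) (by rw [hU]; exact sUnion_sat (hpart π' hπ') hF')
    obtain ⟨B, ⟨hB, hpB⟩, -⟩ := hp π' hπ'
    obtain ⟨y, hy⟩ := (hpart π' hπ').1 B hB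
    have hyU : y ∈ ⋃₀ F' := by rw [← hU, hu]; trivial
    obtain ⟨C, hC, hyC⟩ := hyU
    have := part_eq (hpart π' hπ') hB (hF' hC) hy hyC
    exact ⟨B, this ▸ hC, hpB⟩

/-- The trace of a Keller family on a line lies in one partition. -/
lemma trace_subset {d : ℕ} {X : Fin d → Type*} {P : ∀ i, Set (Set (Set (X i)))}
    (hsys : IsBoxSystem X P) {G : Set (∀ i, Set (X i))} (hG : IsKellerFamily P G) (j : Fin d)
    (p : ∀ i, Set (X i) → Prop) (hp : ∀ i, IsSelector (P i) (p i))
    (hne : ∃ K ∈ G, ∀ i, i ≠ j → p i (K i)) :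
    ∃ π ∈ P j, {A | ∃ K ∈ G, K j = A ∧ ∀ i, i ≠ j → p i (K i)} ⊆ π := by
  obtain ⟨K, hK, hpK⟩ := hne
  obtain ⟨π, hπ, hKπ⟩ := hG.2.1 K hK j
  refine ⟨π, hπ, ?_⟩
  rintro A ⟨L, hL, rfl, hpL⟩
  by_cases h : K = L
  · exact h ▸ hKπ
  · obtain ⟨i, σ, hσ, h1, h2, h3⟩ := hG.2.2 K hK L hL h
    by_cases hij : i = j
    · subst hij
      rw [part_unique (hsys.2.2.2.1 i) (hsys.2.2.2.2 i) hπ hσ hKπ h1]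
      exact h2
    · exact absurd ((hp i σ hσ).unique ⟨h1, hpK i hij⟩ ⟨h2, hpL i hij⟩) h3

/-- Suits of the same polybox are hit by the same mixed selector tuples. -/
lemma selector_transfer {d : ℕ} {X : Fin d → Type*} {P : ∀ i, Set (Set (Set (X i)))}
    (hsys : IsBoxSystem X P) (T : Finset (Fin d)) :
    ∀ (G H : Set (∀ i, Set (X i))), IsKellerFamily P G → IsKellerFamily P H →
    polyUnion G = polyUnion H →
    ∀ p : ∀ i, Set (X i) → Prop, (∀ i, IsSelector (P i) (p i)) →
    (∀ i, i ∉ T → ∃ x : X i, p i = fun A => x ∈ A) →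
    (∃ K ∈ G, ∀ i, p i (K i)) → ∃ K ∈ H, ∀ i, p i (K i) := by
  classical
  induction T using Finset.induction_on with
  | empty =>
    intro G H _ _ hU p _ hreal ⟨K, hK, hpK⟩
    choose x hx using fun i => hreal i (by simp)
    have hxG : x ∈ polyUnion G := by
      simp only [polyUnion, Set.mem_iUnion, boxSet, Set.mem_univ_pi]
      refine ⟨K, hK, fun i => ?_⟩
      have := hpK i
      rwa [hx i] at this
    rw [hU] at hxG
    simp only [polyUnion, Set.mem_iUnion, boxSet, Set.mem_univ_pi] at hxG
    obtain ⟨L, hL, hxL⟩ := hxG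
    refine ⟨L, hL, fun i => ?_⟩
    rw [hx i]
    exact hxL i
  | insert j T hj ih =>
    intro G H hG hH hU p hp hreal ⟨K, hK, hpK⟩
    -- traces along the line in direction `j`
    have step : ∀ G H : Set (∀ i, Set (X i)), IsKellerFamily P G → IsKellerFamily P H →
        polyUnion G = polyUnion H →
        ⋃₀ {A | ∃ K ∈ G, K j = A ∧ ∀ i, i ≠ j → p i (K i)} ⊆
        ⋃₀ {A | ∃ K ∈ H, K j = A ∧ ∀ i, i ≠ j → p i (K i)} := by
      rintro G H hG hH hU x ⟨A, ⟨K, hK, rfl, hpK⟩, hxK⟩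
      have main : ∃ L ∈ H, ∀ i, Function.update p j (fun A => x ∈ A) i (L i) := by
        refine ih G H hG hH hU (Function.update p j (fun A => x ∈ A)) ?_ ?_ ⟨K, hK, ?_⟩
        · intro i
          by_cases hi : i = j
          · subst hi
            simpa using point_selector (hsys.2.2.2.1 i) x
          · simpa [Function.update_of_ne hi] using hp i
        · intro i hiT
          by_cases hi : i = j
          · subst hi
            exact ⟨x, by simp⟩
          · rw [Function.update_of_ne hi]
            exact hreal i (by simp [hi, hiT])
        · intro i
          by_cases hi : i = j
          · subst hi
            simpa using hxK
          · simpa [Function.update_of_ne hi] using hpK i hi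
      obtain ⟨L, hL, hpL⟩ := main
      refine ⟨L j, ⟨L, hL, rfl, fun i hi => ?_⟩, ?_⟩
      · simpa [Function.update_of_ne hi] using hpL i
      · simpa using hpL j
    have hSU := Set.Subset.antisymm (step G H hG hH hU) (step H G hH hG hU.symm)
    obtain ⟨π, hπ, hF⟩ := trace_subset hsys hG j p hp ⟨K, hK, fun i _ => hpK i⟩
    have hneH : ∃ K ∈ H, ∀ i, i ≠ j → p i (K i) := by
      have hKm : K j ∈ {A | ∃ K ∈ G, K j = A ∧ ∀ i, i ≠ j → p i (K i)} :=
        ⟨K, hK, rfl, fun i _ => hpK i⟩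
      obtain ⟨x, hx⟩ := (hsys.2.2.2.1 j π hπ).1 _ (hF hKm)
      obtain ⟨A, ⟨L, hL, -, hpL⟩, -⟩ := hSU.subset ⟨K j, hKm, hx⟩
      exact ⟨L, hL, hpL⟩
    obtain ⟨π', hπ', hF'⟩ := trace_subset hsys hH j p hp hneH
    obtain ⟨A, ⟨L, hL, rfl, hpL⟩, hpA⟩ := one_dim (hsys.2.2.2.1 j) (hsys.2.2.2.2 j) hπ hπ'
      hF hF' hSU (hp j) ⟨K j, ⟨K, hK, rfl, fun i _ => hpK i⟩, hpK j⟩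
    refine ⟨L, hL, fun i => ?_⟩
    by_cases hi : i = j
    · subst hi
      exact hpA
    · exact hpL i hi

/-- A selector choosing two compatible sets. -/
lemma exists_selector {α : Type*} [Nonempty α] {Q : Set (Set (Set α))}
    (hpart : ∀ π ∈ Q, IsPartition π)
    (hind : ∀ π ∈ Q, ∀ π' ∈ Q, π ≠ π' → IndepPartitions π π')
    (A B : Set α) (hA : ∃ π ∈ Q, A ∈ π) (hB : ∃ π ∈ Q, B ∈ π)
    (hAB : ∀ π ∈ Q, A ∈ π → B ∈ π → A = B) :
    ∃ p : Set α → Prop, IsSelector Q p ∧ p A ∧ p B := by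
  have hc : ∀ π : Set (Set α), ∃ C : Set α, π ∈ Q → C ∈ π ∧ (A ∈ π → C = A) ∧
      (B ∈ π → C = B) := by
    intro π
    by_cases hπ : π ∈ Q
    · by_cases h1 : A ∈ π
      · exact ⟨A, fun _ => ⟨h1, fun _ => rfl, fun h => hAB π hπ h1 h⟩⟩
      · by_cases h2 : B ∈ π
        · exact ⟨B, fun _ => ⟨h2, fun h => absurd h h1, fun _ => rfl⟩⟩
        · obtain ⟨C, ⟨hC, -⟩, -⟩ := point_selector hpart (Classical.arbitrary α) π hπ
          exact ⟨C, fun _ => ⟨hC, fun h => absurd h h1, fun h => absurd h h2⟩⟩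
    · exact ⟨∅, fun h => absurd h hπ⟩
  choose c hc using hc
  refine ⟨fun C => ∃ π ∈ Q, C = c π, ?_, ?_, ?_⟩
  · intro π hπ
    refine ⟨c π, ⟨(hc π hπ).1, π, hπ, rfl⟩, ?_⟩
    rintro C ⟨hC, σ, hσ, rfl⟩
    rw [part_unique hpart hind hπ hσ hC (hc σ hσ).1]
  · obtain ⟨π, hπ, h⟩ := hA
    exact ⟨π, hπ, ((hc π hπ).2.1 h).symm⟩
  · obtain ⟨π, hπ, h⟩ := hB
    exact ⟨π, hπ, ((hc π hπ).2.2 h).symm⟩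

/-- If a box satisfies Keller's condition with all boxes of a suit, it does so with all boxes
of every other suit for the same polybox. -/
lemma keller_transfer {d : ℕ} {X : Fin d → Type*} {P : ∀ i, Set (Set (Set (X i)))}
    (hsys : IsBoxSystem X P) {G H : Set (∀ i, Set (X i))} (hG : IsKellerFamily P G)
    (hH : IsKellerFamily P H) (hU : polyUnion G = polyUnion H) {L : ∀ i, Set (X i)}
    (hL : IsBox P L) (hLG : ∀ K ∈ G, KellerPair P K L) : ∀ K ∈ H, KellerPair P K L := by
  intro K hK
  by_contra hcon
  have hsel : ∀ i, ∃ p : Set (X i) → Prop, IsSelector (P i) p ∧ p (K i) ∧ p (L i) := by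
    intro i
    haveI := hsys.1 i
    refine exists_selector (hsys.2.2.2.1 i) (hsys.2.2.2.2 i) (K i) (L i) (hH.2.1 K hK i) (hL i) ?_
    intro π hπ h1 h2
    by_contra hne
    exact hcon ⟨i, π, hπ, h1, h2, hne⟩
  choose p hp hpK hpL using hsel
  obtain ⟨M, hM, hpM⟩ := selector_transfer hsys Finset.univ H G hH hG hU.symm p hp
    (by simp) ⟨K, hK, hpK⟩
  obtain ⟨i, π, hπ, h1, h2, h3⟩ := hLG M hM
  exact h3 ((hp i π hπ).unique ⟨h1, hpM i⟩ ⟨h2, hpL i⟩)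

lemma KellerPair.swap {d : ℕ} {X : Fin d → Type*} {P : ∀ i, Set (Set (Set (X i)))}
    {K L : ∀ i, Set (X i)} (h : KellerPair P K L) : KellerPair P L K := by
  obtain ⟨i, π, hπ, h1, h2, h3⟩ := h
  exact ⟨i, π, hπ, h2, h1, h3.symm⟩

theorem stmt_16 {d : ℕ} {X : Fin d → Type*} (P : ∀ i, Set (Set (Set (X i))))
    (hsys : IsBoxSystem X P) (hunital : ∀ i, {Set.univ} ∈ P i)
    (s : ℕ) (G H : Fin s → Set (∀ i, Set (X i)))
    (hGdisj : ∀ a b, a ≠ b → Disjoint (G a) (G b))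
    (hHdisj : ∀ a b, a ≠ b → Disjoint (H a) (H b))
    (hsuits : ∀ a, IsKellerFamily P (G a) ∧ IsKellerFamily P (H a) ∧
      polyUnion (G a) = polyUnion (H a))
    (hbig : IsKellerFamily P (⋃ a, G a)) :
    IsKellerFamily P (⋃ a, H a) ∧ polyUnion (⋃ a, H a) = polyUnion (⋃ a, G a) := by
  have hU : polyUnion (⋃ a, H a) = polyUnion (⋃ a, G a) := by
    have e : ∀ F : Fin s → Set (∀ i, Set (X i)),
        polyUnion (⋃ a, F a) = ⋃ a, polyUnion (F a) := by
      intro F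
      exact Set.biUnion_iUnion F boxSet
    rw [e, e]
    exact Set.iUnion_congr fun a => (hsuits a).2.2.symm
  refine ⟨⟨?_, ?_, ?_⟩, hU⟩
  · obtain ⟨K, hK⟩ := hbig.1
    obtain ⟨a, -⟩ := Set.mem_iUnion.mp hK
    obtain ⟨L, hL⟩ := (hsuits a).2.1.1
    exact ⟨L, Set.mem_iUnion.mpr ⟨a, hL⟩⟩
  · intro K hK
    obtain ⟨a, ha⟩ := Set.mem_iUnion.mp hK
    exact (hsuits a).2.1.2.1 K ha
  · intro K hK L hL hKL
    obtain ⟨a, ha⟩ := Set.mem_iUnion.mp hK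
    obtain ⟨b, hb⟩ := Set.mem_iUnion.mp hL
    by_cases hab : a = b
    · subst hab
      exact (hsuits a).2.1.2.2 K ha L hb hKL
    · have h1 : ∀ M ∈ G b, ∀ N ∈ H a, KellerPair P N M := by
        intro M hM
        refine keller_transfer hsys (hsuits a).1 (hsuits a).2.1 (hsuits a).2.2
          ((hsuits b).1.2.1 M hM) ?_
        intro N hN
        refine hbig.2.2 N (Set.mem_iUnion.mpr ⟨a, hN⟩) M (Set.mem_iUnion.mpr ⟨b, hM⟩) ?_
        rintro rfl
        exact Set.disjoint_left.mp (hGdisj a b hab) hN hM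
      exact (keller_transfer hsys (hsuits b).1 (hsuits b).2.1 (hsuits b).2.2
        ((hsuits a).2.1.2.1 K ha) (fun M hM => (h1 M hM K ha).swap) L hb).swap
end

section
/- Let m ≥ 2 be an integer and U = [0, m), with addition ⊕ modulo m. For every t ∈ [0,1) let π_t = {[0,1) ⊕ t ⊕ k : k ∈ {0,…,m−1}}. Then Π = {π_t : t ∈ [0,1)} ∪ {{U}} is a unital, complete family of pairwise independent partitions of U. -/
open Set

/-- `amod r m` is the representative of `r` modulo `m` in `[0, m)`. -/
noncomputable def amod (r : ℝ) (m : ℕ) : ℝ := r - (m : ℝ) * (⌊r / (m : ℝ)⌋ : ℝ)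

/-- The torus `T^d_m = [0,m_1) × ⋯ × [0,m_d)`. -/
def torus {d : ℕ} (m : Fin d → ℕ) : Set (Fin d → ℝ) :=
  {x | ∀ i, x i ∈ Set.Ico (0 : ℝ) (m i)}

/-- The translated unit cube `[0,1)^d ⊕ t` inside the torus. -/
def cube {d : ℕ} (m : Fin d → ℕ) (t : Fin d → ℝ) : Set (Fin d → ℝ) :=
  {x ∈ torus m | ∀ i, amod (x i - t i) (m i) < 1}

/-- `[0,1)^d ⊕ T` is a cube tiling of the torus: a partition of `T^d_m` into translated
unit cubes. -/
def IsCubeTiling {d : ℕ} (m : Fin d → ℕ) (T : Set (Fin d → ℝ)) : Prop :=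
  T ⊆ torus m ∧ (∀ s ∈ T, ∀ t ∈ T, s ≠ t → Disjoint (cube m s) (cube m t)) ∧
    ⋃ t ∈ T, cube m t = torus m

/-- `p_i(T) = {t_i mod 1 : t ∈ T}`. -/
def pset {d : ℕ} (T : Set (Fin d → ℝ)) (i : Fin d) : Set ℝ :=
  (fun t => Int.fract (t i)) '' T

/-- The unit segment `[0,1) ⊕ c` inside `[0,m)`, as a subset of the subtype. -/
def segPart (m : ℕ) (c : ℝ) : Set ↥(Set.Ico (0 : ℝ) (m : ℝ)) :=
  {x | amod ((x : ℝ) - c) m < 1}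

/-- The unit-segment partition `π_t = {[0,1) ⊕ t ⊕ k : k ∈ {0,…,m-1}}` of `[0,m)`. -/
def segPartition (m : ℕ) (t : ℝ) : Set (Set ↥(Set.Ico (0 : ℝ) (m : ℝ))) :=
  {A | ∃ k : ℕ, k < m ∧ A = segPart m (t + (k : ℝ))}

/-- The family of partitions of `[0,m)` consisting of the trivial partition together with
all unit-segment partitions `π_t`, `t ∈ [0,1)`. -/
def segSystem (m : ℕ) : Set (Set (Set ↥(Set.Ico (0 : ℝ) (m : ℝ)))) :=
  insert {Set.univ} {π | ∃ t ∈ Set.Ico (0 : ℝ) 1, π = segPartition m t}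


lemma aux_amod_mem (m : ℕ) (hm : 2 ≤ m) (r : ℝ) : amod r m ∈ Set.Ico (0:ℝ) (m:ℝ) := by
  have hm0 : (0:ℝ) < m := by positivity
  have h1 := Int.floor_le (r / (m:ℝ))
  have h2 := Int.lt_floor_add_one (r / (m:ℝ))
  rw [le_div_iff₀ hm0] at h1
  rw [div_lt_iff₀ hm0] at h2
  unfold amod
  constructor <;> nlinarith

noncomputable def auxWrap (m : ℕ) (hm : 2 ≤ m) (r : ℝ) : ↥(Set.Ico (0 : ℝ) (m : ℝ)) :=
  ⟨amod r m, aux_amod_mem m hm r⟩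

/-- Membership in a segment in terms of integer translates. -/
lemma aux_mem_seg (m : ℕ) (hm : 2 ≤ m) (c : ℝ) (x : ↥(Set.Ico (0 : ℝ) (m : ℝ))) :
    x ∈ segPart m c ↔ ∃ z : ℤ, c + m * z ≤ x ∧ (x:ℝ) < c + m * z + 1 := by
  have hm2 : (2:ℝ) ≤ m := by exact_mod_cast hm
  have hm0 : (0:ℝ) < m := by linarith
  constructor
  · intro h
    have h' : amod ((x:ℝ) - c) m < 1 := h
    have h0 := (aux_amod_mem m hm ((x:ℝ) - c)).1
    unfold amod at h' h0
    exact ⟨⌊((x:ℝ) - c) / m⌋, by linarith, by linarith⟩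
  · rintro ⟨z, h1, h2⟩
    have hz : ⌊((x:ℝ) - c) / m⌋ = z := by
      rw [Int.floor_eq_iff, le_div_iff₀ hm0, div_lt_iff₀ hm0]
      constructor <;> nlinarith
    change amod ((x:ℝ) - c) m < 1
    unfold amod
    rw [hz]
    linarith

lemma aux_wrap_mem (m : ℕ) (hm : 2 ≤ m) (c r : ℝ) :
    auxWrap m hm r ∈ segPart m c ↔ ∃ z : ℤ, c + m * z ≤ r ∧ r < c + m * z + 1 := by
  rw [aux_mem_seg m hm]
  have e : ((auxWrap m hm r : ↥(Set.Ico (0 : ℝ) (m : ℝ))) : ℝ)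
    = r - (m : ℝ) * (⌊r / (m : ℝ)⌋ : ℝ) := rfl
  rw [e]
  constructor
  · rintro ⟨z, h1, h2⟩
    refine ⟨z + ⌊r / (m : ℝ)⌋, ?_, ?_⟩ <;> push_cast <;> linarith
  · rintro ⟨z, h1, h2⟩
    refine ⟨z - ⌊r / (m : ℝ)⌋, ?_, ?_⟩ <;> push_cast <;> linarith

lemma aux_wrap_mem_self (m : ℕ) (hm : 2 ≤ m) (c r : ℝ) (h1 : c ≤ r) (h2 : r < c + 1) :
    auxWrap m hm r ∈ segPart m c :=
  (aux_wrap_mem m hm c r).2 ⟨0, by simpa using h1, by simpa using h2⟩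

lemma aux_seg_shift (m : ℕ) (hm : 2 ≤ m) (c : ℝ) (w : ℤ) :
    segPart m (c + m * w) = segPart m c := by
  ext x
  rw [aux_mem_seg m hm, aux_mem_seg m hm]
  constructor
  · rintro ⟨z, h1, h2⟩
    refine ⟨z + w, ?_, ?_⟩ <;> push_cast <;> linarith
  · rintro ⟨z, h1, h2⟩
    refine ⟨z - w, ?_, ?_⟩ <;> push_cast <;> linarith

lemma aux_seg_int (m : ℕ) (hm : 2 ≤ m) (t : ℝ) (n : ℤ) :
    segPart m (t + n) ∈ segPartition m t := by
  have hm0 : (0:ℤ) < m := by omega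
  have h0 := Int.emod_nonneg n hm0.ne'
  have h1 := Int.emod_lt_of_pos n hm0
  have h2 := Int.emod_add_mul_ediv n m
  refine ⟨(n % m).toNat, by omega, ?_⟩
  have h3 : (((n % m).toNat : ℕ) : ℝ) = ((n % m : ℤ) : ℝ) := by
    exact_mod_cast Int.toNat_of_nonneg h0
  rw [h3, ← aux_seg_shift m hm (t + ((n % m : ℤ) : ℝ)) (n / m)]
  congr 1
  have h4 : ((n % m : ℤ) : ℝ) + m * ((n / m : ℤ) : ℝ) = n := by exact_mod_cast h2
  linarith

lemma aux_part_eq {α : Type*} {ρ : Set (Set α)} (h : IsPartition ρ) {A B : Set α}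
    (hA : A ∈ ρ) (hB : B ∈ ρ) {x : α} (hxA : x ∈ A) (hxB : x ∈ B) : A = B := by
  by_contra hne
  exact Set.disjoint_left.1 (h.2.1 hA hB hne) hxA hxB

lemma aux_sub_eq {α : Type*} {π ρ : Set (Set α)} (hπ : ⋃₀ π = Set.univ) (hρ : IsPartition ρ)
    (h : π ⊆ ρ) : ρ = π := by
  apply Set.Subset.antisymm _ h
  intro A hA
  obtain ⟨x, hx⟩ := hρ.1 A hA
  have : x ∈ ⋃₀ π := by rw [hπ]; trivial
  obtain ⟨B, hB, hxB⟩ := this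
  rw [aux_part_eq hρ hA (h hB) hx hxB]
  exact hB

lemma aux_univ {α : Type*} {ρ : Set (Set α)} (hρ : IsPartition ρ) (h : Set.univ ∈ ρ) :
    ρ = {Set.univ} :=
  aux_sub_eq (by simp) hρ (by simpa using h)

lemma aux_mem_floor (m : ℕ) (hm : 2 ≤ m) (t : ℝ) (x : ↥(Set.Ico (0 : ℝ) (m : ℝ))) :
    x ∈ segPart m (t + (⌊(x:ℝ) - t⌋ : ℤ)) := by
  rw [aux_mem_seg m hm]
  have h1 := Int.floor_le ((x:ℝ) - t)
  have h2 := Int.lt_floor_add_one ((x:ℝ) - t)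
  refine ⟨0, ?_, ?_⟩ <;> push_cast <;> linarith

lemma aux_isPartition (m : ℕ) (hm : 2 ≤ m) (t : ℝ) : IsPartition (segPartition m t) := by
  refine ⟨?_, ?_, ?_⟩
  · rintro A ⟨k, hk, rfl⟩
    exact ⟨auxWrap m hm (t + k), aux_wrap_mem_self m hm _ _ le_rfl (by linarith)⟩
  · rintro A ⟨k, hk, rfl⟩ B ⟨j, hj, rfl⟩ hne
    refine Set.disjoint_left.2 fun x hx hy => hne ?_
    obtain ⟨z, h1, h2⟩ := (aux_mem_seg m hm _ _).1 hx
    obtain ⟨w, h3, h4⟩ := (aux_mem_seg m hm _ _).1 hy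
    have a : (k:ℤ) + m * z < j + m * w + 1 := by
      have : (k:ℝ) + m * z < j + m * w + 1 := by linarith
      exact_mod_cast this
    have b : (j:ℤ) + m * w < k + m * z + 1 := by
      have : (j:ℝ) + m * w < k + m * z + 1 := by linarith
      exact_mod_cast this
    have c : (k:ℤ) + m * z = j + m * w := by omega
    have d := congrArg (· % (m:ℤ)) c
    simp only [Int.add_mul_emod_self_left] at d
    rw [Int.emod_eq_of_lt (by omega) (by omega), Int.emod_eq_of_lt (by omega) (by omega)] at d
    have e : k = j := by exact_mod_cast d
    rw [e]
  · refine Set.eq_univ_of_forall fun x => ?_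
    exact ⟨_, aux_seg_int m hm t _, aux_mem_floor m hm t x⟩

lemma aux_indep (m : ℕ) (hm : 2 ≤ m) (s t : ℝ) (h1 : s < t) (h2 : t < s + 1)
    (ρ : Set (Set ↥(Set.Ico (0 : ℝ) (m : ℝ)))) (hρ : IsPartition ρ)
    (hs : Coarser (segPartition m s) ρ) (ht : Coarser (segPartition m t) ρ) :
    ρ = {Set.univ} := by
  choose B hB hBs using fun n : ℤ => ht _ (aux_seg_int m hm t n)
  have step : ∀ n : ℤ, B (n + 1) = B n := by
    intro n
    obtain ⟨C, hC, hCs⟩ := hs _ (aux_seg_int m hm s (n + 1))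
    have e1 : B n = C := aux_part_eq hρ (hB n) hC (x := auxWrap m hm (s + (n + 1 : ℤ)))
      (hBs n (aux_wrap_mem_self m hm _ _ (by push_cast; linarith) (by push_cast; linarith)))
      (hCs (aux_wrap_mem_self m hm _ _ le_rfl (by linarith)))
    have e2 : B (n + 1) = C := aux_part_eq hρ (hB _) hC (x := auxWrap m hm (t + (n + 1 : ℤ)))
      (hBs _ (aux_wrap_mem_self m hm _ _ le_rfl (by linarith)))
      (hCs (aux_wrap_mem_self m hm _ _ (by linarith) (by linarith)))
    rw [e1, e2]
  have all : ∀ n : ℤ, B n = B 0 := by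
    intro n
    induction n using Int.induction_on with
    | zero => rfl
    | succ i ih => rw [step, ih]
    | pred i ih =>
      have := step (-(i:ℤ) - 1)
      rw [sub_add_cancel] at this
      rw [← this, ih]
  have hu : B 0 = Set.univ := by
    refine Set.eq_univ_of_forall fun x => ?_
    rw [← all ⌊(x:ℝ) - t⌋]
    exact hBs _ (aux_mem_floor m hm t x)
  exact aux_univ hρ (hu ▸ hB 0)

lemma aux_step (m : ℕ) (hm : 2 ≤ m) (ρ : Set (Set ↥(Set.Ico (0 : ℝ) (m : ℝ))))
    (hρ : IsPartition ρ) (hseg : ∀ A ∈ ρ, ∃ c, A = segPart m c) (c : ℝ)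
    (hc : segPart m c ∈ ρ) : segPart m (c + 1) ∈ ρ := by
  have : auxWrap m hm (c + 1) ∈ ⋃₀ ρ := by rw [hρ.2.2]; trivial
  obtain ⟨A, hA, hxA⟩ := this
  obtain ⟨d, rfl⟩ := hseg A hA
  obtain ⟨z, h1, h2⟩ := (aux_wrap_mem m hm _ _).1 hxA
  rw [← aux_seg_shift m hm d z] at hA hxA
  rcases h1.eq_or_lt with h | h
  · rwa [h] at hA
  · exfalso
    have e : segPart m c = segPart m (d + m * z) :=
      aux_part_eq hρ hc hA (x := auxWrap m hm (d + m * z))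
        (aux_wrap_mem_self m hm _ _ (by linarith) h)
        (aux_wrap_mem_self m hm _ _ le_rfl (by linarith))
    rw [← e] at hxA
    obtain ⟨w, h3, h4⟩ := (aux_wrap_mem m hm _ _).1 hxA
    have a : (m:ℤ) * w < 2 := by
      have : (m:ℝ) * w < 2 := by linarith
      exact_mod_cast this
    have b : 0 < (m:ℤ) * w := by
      have : 0 < (m:ℝ) * w := by linarith
      exact_mod_cast this
    have hm' : (2:ℤ) ≤ m := by exact_mod_cast hm
    have hw : 0 < w := by
      by_contra hw
      nlinarith
    nlinarith

theorem stmt_17 (m : ℕ) (hm : 2 ≤ m) :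
    (∀ π ∈ segSystem m, IsPartition π) ∧
      ({Set.univ} ∈ segSystem m) ∧
      (∀ π ∈ segSystem m, ∀ π' ∈ segSystem m, π ≠ π' → IndepPartitions π π') ∧
      (∀ ρ : Set (Set ↥(Set.Ico (0 : ℝ) (m : ℝ))), IsPartition ρ →
        (∀ A ∈ ρ, ∃ π ∈ segSystem m, A ∈ π) → ρ ∈ segSystem m) := by
  refine ⟨?_, Or.inl rfl, ?_, ?_⟩
  · rintro π (rfl | ⟨t, ht, rfl⟩)
    · refine ⟨?_, by simp, by simp⟩
      rintro A rfl
      exact ⟨auxWrap m hm 0, trivial⟩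
    · exact aux_isPartition m hm t
  · have triv : ∀ ρ : Set (Set ↥(Set.Ico (0 : ℝ) (m : ℝ))), IsPartition ρ →
        Coarser {Set.univ} ρ → ρ = {Set.univ} := by
      intro ρ hρ h
      obtain ⟨B, hB, hs⟩ := h _ rfl
      rw [Set.univ_subset_iff.1 hs] at hB
      exact aux_univ hρ hB
    rintro π (rfl | ⟨t, ht, rfl⟩) π' (rfl | ⟨s, hs, rfl⟩) hne ρ hρ h1 h2
    · exact triv ρ hρ h1
    · exact triv ρ hρ h1
    · exact triv ρ hρ h2
    · have hts : t ≠ s := fun h => hne (by rw [h])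
      obtain ⟨ht0, ht1⟩ := ht
      obtain ⟨hs0, hs1⟩ := hs
      rcases lt_or_gt_of_ne hts with h | h
      · exact aux_indep m hm t s h (by linarith) ρ hρ h1 h2
      · exact aux_indep m hm s t h (by linarith) ρ hρ h2 h1
  · intro ρ hρ hA
    by_cases hu : Set.univ ∈ ρ
    · exact Or.inl (aux_univ hρ hu)
    right
    have hseg' : ∀ A ∈ ρ, ∃ t ∈ Set.Ico (0:ℝ) 1, ∃ k : ℕ, A = segPart m (t + k) := by
      intro A hAρ
      obtain ⟨π, (rfl | ⟨t, ht, rfl⟩), hAπ⟩ := hA A hAρ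
      · exact absurd (hAπ ▸ hAρ) hu
      · obtain ⟨k, -, rfl⟩ := hAπ
        exact ⟨t, ht, k, rfl⟩
    have hseg : ∀ A ∈ ρ, ∃ c, A = segPart m c := fun A h => by
      obtain ⟨t, -, k, h⟩ := hseg' A h
      exact ⟨_, h⟩
    have : auxWrap m hm 0 ∈ ⋃₀ ρ := by rw [hρ.2.2]; trivial
    obtain ⟨A, hAρ, -⟩ := this
    obtain ⟨t, ht, k, rfl⟩ := hseg' A hAρ
    refine ⟨t, ht, aux_sub_eq (aux_isPartition m hm t).2.2 hρ ?_⟩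
    have hall : ∀ j : ℕ, segPart m (t + k + j) ∈ ρ := by
      intro j
      induction j with
      | zero => simpa using hAρ
      | succ j ih =>
        have := aux_step m hm ρ hρ hseg _ ih
        push_cast
        rwa [← add_assoc]
    rintro A ⟨j, hj, rfl⟩
    obtain ⟨n, hn⟩ : ∃ n : ℕ, k + n = j + m * k := by
      refine ⟨j + m * k - k, ?_⟩
      have : k ≤ m * k := Nat.le_mul_of_pos_left k (by omega)
      omega
    have hn' : (k:ℝ) + n = j + m * k := by exact_mod_cast hn
    have h := hall n
    have e : t + k + (n:ℝ) = t + j + m * ((k:ℤ):ℝ) := by push_cast; linarith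
    rwa [e, aux_seg_shift m hm] at h
end
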